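/- If C : {0,1}^n → ({0,1}^ℓ)^m is a (2, δ, ε)-locally decodable code using b bits, then m ≥ 2^{d·n − log₂ u}, where u = Σ_{i=0}^{b} binom(ℓ, i) and d = (1 − H(1/2 + ε/2^{b+1})) · δ · 2^b / u. -/

import Mathlib

/-- A decoding tuple `(j0, j1, S0, S1, f)` for a 2-query decoder: two query positions,
two sets of answer bits, and an output function (taking the full `ℓ`-bit answers;
the requirement that it only depends on the bits in `S0`/`S1` is `DecTuple.Valid`). -/
structure DecTuple (m ℓ : ℕ) where
  j0 : Fin m
  j1 : Fin m
  S0 : Finset (Fin ℓ)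
  S1 : Finset (Fin ℓ)
  f : (Fin ℓ → Bool) → (Fin ℓ → Bool) → Bool
deriving DecidableEq

/-- Decoding tuples form a finite type. -/
def DecTuple.equivProd (m ℓ : ℕ) :
    (Fin m × Fin m × Finset (Fin ℓ) × Finset (Fin ℓ) ×
      ((Fin ℓ → Bool) → (Fin ℓ → Bool) → Bool)) ≃ DecTuple m ℓ where
  toFun p := ⟨p.1, p.2.1, p.2.2.1, p.2.2.2.1, p.2.2.2.2⟩
  invFun ω := ⟨ω.j0, ω.j1, ω.S0, ω.S1, ω.f⟩
  left_inv _ := rfl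
  right_inv _ := rfl

instance (m ℓ : ℕ) : Fintype (DecTuple m ℓ) :=
  Fintype.ofEquiv _ (DecTuple.equivProd m ℓ)

/-- A decoding tuple is valid for `b` used bits if the two queried positions are
distinct, the two sets have size `b`, and the output function depends only on the
answer bits in `S0` resp. `S1`. -/
def DecTuple.Valid {m ℓ : ℕ} (b : ℕ) (ω : DecTuple m ℓ) : Prop :=
  ω.j0 ≠ ω.j1 ∧ ω.S0.card = b ∧ ω.S1.card = b ∧
    ∀ a0 a1 a0' a1' : Fin ℓ → Bool,
      (∀ k ∈ ω.S0, a0 k = a0' k) → (∀ k ∈ ω.S1, a1 k = a1' k) →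
        ω.f a0 a1 = ω.f a0' a1'

/-- `D` is a distribution over decoding tuples witnessing that `C` is a
`(2, c, ε)`-smooth code using `b` bits at index `i`. -/
def IsSmoothDecoder {n m ℓ : ℕ} (b : ℕ) (c ε : ℝ)
    (C : (Fin n → Bool) → Fin m → Fin ℓ → Bool) (i : Fin n)
    (D : DecTuple m ℓ → ℝ) : Prop :=
  (∀ ω, 0 ≤ D ω) ∧ (∑ ω, D ω = 1) ∧
  (∀ ω, D ω ≠ 0 → ω.Valid b) ∧
  (∀ x, 1 / 2 + ε ≤
    ∑ ω ∈ Finset.univ.filter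
      (fun ω : DecTuple m ℓ => ω.f (C x ω.j0) (C x ω.j1) = x i), D ω) ∧
  (∀ j : Fin m,
    ∑ ω ∈ Finset.univ.filter
      (fun ω : DecTuple m ℓ => ω.j0 = j ∨ ω.j1 = j), D ω ≤ c / m)

/-- `C : {0,1}^n → ({0,1}^ℓ)^m` is a `(2, c, ε)`-smooth code using `b` bits. -/
def IsSmoothCode (n m ℓ b : ℕ) (c ε : ℝ)
    (C : (Fin n → Bool) → Fin m → Fin ℓ → Bool) : Prop :=
  ∀ i : Fin n, ∃ D : DecTuple m ℓ → ℝ, IsSmoothDecoder b c ε C i D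

/-- `D` is a distribution over decoding tuples witnessing that `C` is a
`(2, δ, ε)`-locally decodable code using `b` bits at index `i`: decoding succeeds with
probability at least `1/2 + ε` from any `y` differing from `C x` in at most `δm`
positions. -/
def IsLDCDecoder {n m ℓ : ℕ} (b : ℕ) (δ ε : ℝ)
    (C : (Fin n → Bool) → Fin m → Fin ℓ → Bool) (i : Fin n)
    (D : DecTuple m ℓ → ℝ) : Prop :=
  (∀ ω, 0 ≤ D ω) ∧ (∑ ω, D ω = 1) ∧
  (∀ ω, D ω ≠ 0 → ω.Valid b) ∧
  (∀ (x : Fin n → Bool) (y : Fin m → Fin ℓ → Bool),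
    ((Finset.univ.filter fun j => y j ≠ C x j).card : ℝ) ≤ δ * m →
    1 / 2 + ε ≤
      ∑ ω ∈ Finset.univ.filter
        (fun ω : DecTuple m ℓ => ω.f (y ω.j0) (y ω.j1) = x i), D ω)

/-- `C : {0,1}^n → ({0,1}^ℓ)^m` is a `(2, δ, ε)`-locally decodable code using `b` bits. -/
def IsLDC (n m ℓ b : ℕ) (δ ε : ℝ)
    (C : (Fin n → Bool) → Fin m → Fin ℓ → Bool) : Prop :=
  ∀ i : Fin n, ∃ D : DecTuple m ℓ → ℝ, IsLDCDecoder b δ ε C i D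

/-- The binary entropy function `H(p) = -p log₂ p - (1-p) log₂ (1-p)`. -/
noncomputable def binEnt (p : ℝ) : ℝ :=
  -p * Real.logb 2 p - (1 - p) * Real.logb 2 (1 - p)

namespace Matrix.IsHermitian

variable {ι : Type*} [Fintype ι] [DecidableEq ι] {X Y : Matrix ι ι ℝ}

lemma cfc_id_eq (hX : X.IsHermitian) : hX.cfc id = X :=
  hX.spectral_theorem.symm

lemma cfc_one_eq (hX : X.IsHermitian) : hX.cfc (fun _ => 1) = 1 := by
  have : (RCLike.ofReal ∘ (fun _ => (1 : ℝ)) ∘ hX.eigenvalues : ι → ℝ) = fun _ => 1 := by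
    ext; simp
  rw [IsHermitian.cfc, this, Matrix.diagonal_one, map_one]

lemma cfc_mul_eq (hX : X.IsHermitian) (f g : ℝ → ℝ) :
    hX.cfc f * hX.cfc g = hX.cfc (fun t => f t * g t) := by
  simp only [IsHermitian.cfc, ← map_mul, diagonal_mul_diagonal]
  congr 2

lemma cfc_eq_mul (hX : X.IsHermitian) (f : ℝ → ℝ) :
    hX.cfc f = (hX.eigenvectorUnitary : Matrix ι ι ℝ) *
      diagonal (fun a => f (hX.eigenvalues a)) * (hX.eigenvectorUnitary : Matrix ι ι ℝ)ᵀ := by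
  rw [IsHermitian.cfc, Unitary.conjStarAlgAut_apply, Matrix.star_eq_conjTranspose,
    Matrix.conjTranspose_eq_transpose_of_trivial]
  rfl

lemma trace_mul_cfc (hX : X.IsHermitian) (Q : Matrix ι ι ℝ) (f : ℝ → ℝ) :
    (Q * hX.cfc f).trace = ∑ a, f (hX.eigenvalues a) *
      ((hX.eigenvectorUnitary : Matrix ι ι ℝ).col a ⬝ᵥ
        Q *ᵥ (hX.eigenvectorUnitary : Matrix ι ι ℝ).col a) := by
  rw [cfc_eq_mul, ← Matrix.mul_assoc, Matrix.trace_mul_comm, ← Matrix.mul_assoc,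
    ← Matrix.mul_assoc]
  simp only [Matrix.trace, Matrix.diag, Matrix.mul_diagonal]
  refine Finset.sum_congr rfl fun a _ => ?_
  rw [mul_comm, Matrix.mul_assoc]
  rfl

lemma dotProduct_cfc_mulVec (hX : X.IsHermitian) (f : ℝ → ℝ) (v : ι → ℝ) :
    v ⬝ᵥ hX.cfc f *ᵥ v = ∑ a, f (hX.eigenvalues a) *
      ((hX.eigenvectorUnitary : Matrix ι ι ℝ).col a ⬝ᵥ v) ^ 2 := by
  rw [cfc_eq_mul, ← Matrix.mulVec_mulVec, ← Matrix.mulVec_mulVec, Matrix.dotProduct_mulVec,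
    ← Matrix.mulVec_transpose]
  simp only [dotProduct, Matrix.mulVec_diagonal]
  refine Finset.sum_congr rfl fun a _ => ?_
  simp only [Matrix.mulVec, dotProduct, Matrix.transpose_apply, Matrix.col]
  ring

/-- Traces of products of functions of two symmetric matrices are nonnegative combinations of
products of values at the eigenvalues. -/
lemma trace_cfc_mul_cfc (hX : X.IsHermitian) (hY : Y.IsHermitian) (f g : ℝ → ℝ) :
    (hX.cfc f * hY.cfc g).trace = ∑ b, ∑ a,
      ((hX.eigenvectorUnitary : Matrix ι ι ℝ).col a ⬝ᵥ
        (hY.eigenvectorUnitary : Matrix ι ι ℝ).col b) ^ 2 *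
        (f (hX.eigenvalues a) * g (hY.eigenvalues b)) := by
  rw [trace_mul_cfc]
  refine Finset.sum_congr rfl fun b _ => ?_
  rw [dotProduct_cfc_mulVec, Finset.mul_sum]
  exact Finset.sum_congr rfl fun a _ => by ring

/-- Klein's inequality for the exponential. -/
lemma trace_exp_tangent_le (hX : X.IsHermitian) (hY : Y.IsHermitian) :
    (hY.cfc Real.exp).trace + ((X - Y) * hY.cfc Real.exp).trace ≤ (hX.cfc Real.exp).trace := by
  have e1 : (hY.cfc Real.exp).trace = (hX.cfc (fun _ => 1) * hY.cfc Real.exp).trace := by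
    rw [cfc_one_eq, Matrix.one_mul]
  have e2 : (X * hY.cfc Real.exp).trace = (hX.cfc id * hY.cfc Real.exp).trace := by
    rw [cfc_id_eq]
  have e3 : (Y * hY.cfc Real.exp).trace =
      (hX.cfc (fun _ => 1) * hY.cfc (fun t => t * Real.exp t)).trace := by
    rw [cfc_one_eq, Matrix.one_mul]
    conv_lhs => enter [1, 1]; rw [← hY.cfc_id_eq]
    rw [cfc_mul_eq]; rfl
  have e4 : (hX.cfc Real.exp).trace = (hX.cfc Real.exp * hY.cfc (fun _ => 1)).trace := by
    rw [cfc_one_eq, Matrix.mul_one]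
  rw [Matrix.sub_mul, Matrix.trace_sub, e2, e3, e4, e1]
  simp only [trace_cfc_mul_cfc, ← Finset.sum_sub_distrib, ← Finset.sum_add_distrib, ← mul_sub,
    ← mul_add]
  refine Finset.sum_le_sum fun b _ => Finset.sum_le_sum fun a _ =>
    mul_le_mul_of_nonneg_left ?_ (sq_nonneg _)
  have h := Real.add_one_le_exp (hX.eigenvalues a - hY.eigenvalues b)
  have h2 : Real.exp (hX.eigenvalues a) =
    Real.exp (hX.eigenvalues a - hY.eigenvalues b) * Real.exp (hY.eigenvalues b) := by
    rw [← Real.exp_add]; ring_nf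
  rw [h2]
  simp only [id]
  nlinarith [Real.exp_pos (hY.eigenvalues b)]

end Matrix.IsHermitian

/-- The logarithmic mean of two positive numbers is at most their arithmetic mean. -/
lemma sub_mul_exp_sub_exp_le (s t : ℝ) :
    (s - t) * (Real.exp s - Real.exp t) ≤ (s - t) ^ 2 * (Real.exp s + Real.exp t) / 2 := by
  wlog h : t ≤ s generalizing s t
  · have := this t s (le_of_not_ge h)
    linarith
  have key : ∀ x : ℝ, 0 ≤ x → 0 ≤ x * (Real.exp x + 1) - 2 * (Real.exp x - 1) := by
    intro x hx
    have hd : ∀ y : ℝ, HasDerivAt (fun x => x * (Real.exp x + 1) - 2 * (Real.exp x - 1))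
        (1 * (Real.exp y + 1) + y * Real.exp y - 2 * Real.exp y) y := fun y =>
      ((hasDerivAt_id y).mul ((Real.hasDerivAt_exp y).add_const 1)).sub
        (((Real.hasDerivAt_exp y).sub_const 1).const_mul 2)
    have hm : Monotone (fun x => x * (Real.exp x + 1) - 2 * (Real.exp x - 1)) := by
      refine monotone_of_deriv_nonneg (fun y => (hd y).differentiableAt) fun y => ?_
      rw [(hd y).deriv]
      have h1 := Real.add_one_le_exp (-y)
      have h2 : Real.exp (-y) * Real.exp y = 1 := by rw [← Real.exp_add]; simp
      nlinarith [Real.exp_pos y]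
    simpa using hm hx
  have h1 := key (s - t) (by linarith)
  have h2 : Real.exp s = Real.exp (s - t) * Real.exp t := by
    rw [← Real.exp_add]; ring_nf
  rw [h2]
  have h3 := mul_nonneg (mul_nonneg h1 (sub_nonneg.2 h)) (Real.exp_pos t).le
  nlinarith

namespace Matrix.IsHermitian

variable {ι : Type*} [Fintype ι] [DecidableEq ι] {X Y : Matrix ι ι ℝ}

lemma trace_sub_mul_exp_sub_exp_le (hX : X.IsHermitian) (hY : Y.IsHermitian) :
    ((X - Y) * (hX.cfc Real.exp - hY.cfc Real.exp)).trace ≤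
      ((X - Y) * (X - Y) * (hX.cfc Real.exp + hY.cfc Real.exp)).trace / 2 := by
  have main : ∀ {P Q : Matrix ι ι ℝ} (hP : P.IsHermitian) (hQ : Q.IsHermitian),
      ((P - Q) * hP.cfc Real.exp).trace =
          (hP.cfc (fun t => t * Real.exp t) * hQ.cfc (fun _ => 1)).trace -
          (hP.cfc Real.exp * hQ.cfc id).trace ∧
      ((P - Q) * (P - Q) * hP.cfc Real.exp).trace =
          (hP.cfc (fun t => t * (t * Real.exp t)) * hQ.cfc (fun _ => 1)).trace -
          2 * (hP.cfc (fun t => t * Real.exp t) * hQ.cfc id).trace +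
          (hP.cfc Real.exp * hQ.cfc (fun t => t * t)).trace := by
    intro P Q hP hQ
    have a1 : hP.cfc (fun t => t * Real.exp t) = P * hP.cfc Real.exp := by
      conv_rhs => enter [1]; rw [← hP.cfc_id_eq]
      rw [cfc_mul_eq]; rfl
    have a1' : hP.cfc (fun t => t * Real.exp t) = hP.cfc Real.exp * P := by
      conv_rhs => enter [2]; rw [← hP.cfc_id_eq]
      rw [cfc_mul_eq]; simp only [id, mul_comm]
    have a2 : hP.cfc (fun t => t * (t * Real.exp t)) = P * (P * hP.cfc Real.exp) := by
      rw [← a1]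
      conv_rhs => enter [1]; rw [← hP.cfc_id_eq]
      rw [cfc_mul_eq]; rfl
    have a3 : hQ.cfc (fun t => t * t) = Q * Q := by
      conv_rhs => rw [← hQ.cfc_id_eq]
      rw [cfc_mul_eq]; rfl
    constructor
    · rw [a1, cfc_one_eq, cfc_id_eq, Matrix.mul_one, Matrix.sub_mul, Matrix.trace_sub,
        Matrix.trace_mul_comm Q]
    · have e : (P - Q) * (P - Q) * hP.cfc Real.exp = P * (P * hP.cfc Real.exp)
          - P * (Q * hP.cfc Real.exp) - Q * (P * hP.cfc Real.exp) + (Q * Q) * hP.cfc Real.exp := by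
        noncomm_ring
      rw [e, a2, a3, cfc_one_eq, cfc_id_eq, Matrix.mul_one, Matrix.trace_add, Matrix.trace_sub,
        Matrix.trace_sub, Matrix.trace_mul_comm (Q * Q), ← a1, Matrix.trace_mul_comm Q,
        Matrix.trace_mul_comm P (Q * _), Matrix.mul_assoc Q, ← a1', Matrix.trace_mul_comm Q]
      ring
  obtain ⟨m1, m2⟩ := main hX hY
  obtain ⟨k1, k2⟩ := main hY hX
  have n1 : (X - Y) * hY.cfc Real.exp = -((Y - X) * hY.cfc Real.exp) := by noncomm_ring
  have n2 : (X - Y) * (X - Y) * hY.cfc Real.exp = (Y - X) * (Y - X) * hY.cfc Real.exp := by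
    noncomm_ring
  rw [Matrix.mul_sub, Matrix.mul_add, Matrix.trace_sub, Matrix.trace_add, n1, n2,
    Matrix.trace_neg, m1, m2, k1, k2]
  rw [Matrix.trace_mul_comm (hY.cfc _) (hX.cfc fun _ => 1),
    Matrix.trace_mul_comm (hY.cfc _) (hX.cfc id), Matrix.trace_mul_comm (hY.cfc _) (hX.cfc _),
    Matrix.trace_mul_comm (hY.cfc _) (hX.cfc _), Matrix.trace_mul_comm (hY.cfc _) (hX.cfc _)]
  simp only [trace_cfc_mul_cfc]
  rw [← sub_nonneg]
  simp only [← Finset.sum_sub_distrib, ← Finset.sum_add_distrib, ← Finset.sum_neg_distrib,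
    Finset.mul_sum, Finset.sum_div]
  refine Finset.sum_nonneg fun b _ => Finset.sum_nonneg fun a _ => ?_
  have := mul_le_mul_of_nonneg_left
    (sub_mul_exp_sub_exp_le (hX.eigenvalues a) (hY.eigenvalues b)) (sq_nonneg
      ((hX.eigenvectorUnitary : Matrix ι ι ℝ).col a ⬝ᵥ
        (hY.eigenvectorUnitary : Matrix ι ι ℝ).col b))
  simp only [id]
  linarith

lemma trace_mul_exp_nonneg (hX : X.IsHermitian) {Q : Matrix ι ι ℝ}
    (hQ : ∀ v : ι → ℝ, 0 ≤ v ⬝ᵥ Q *ᵥ v) : 0 ≤ (Q * hX.cfc Real.exp).trace := by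
  rw [trace_mul_cfc]
  exact Finset.sum_nonneg fun a _ => mul_nonneg (Real.exp_pos _).le (hQ _)

lemma le_trace_exp (hX : X.IsHermitian) {v : ι → ℝ} (hv : v ⬝ᵥ v = 1) (c : ℝ) :
    Real.exp c * (1 + v ⬝ᵥ X *ᵥ v - c) ≤ (hX.cfc Real.exp).trace := by
  have h1 := dotProduct_cfc_mulVec hX (fun _ => 1) v
  rw [cfc_one_eq, Matrix.one_mulVec, hv] at h1
  have h2 := dotProduct_cfc_mulVec hX id v
  rw [cfc_id_eq] at h2
  have h3 := trace_cfc_mul_cfc hX hX Real.exp (fun _ => 1)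
  have h4 := trace_mul_cfc hX 1 Real.exp
  rw [Matrix.one_mul] at h4
  have horth : ∀ a, (hX.eigenvectorUnitary : Matrix ι ι ℝ).col a ⬝ᵥ
      (hX.eigenvectorUnitary : Matrix ι ι ℝ).col a = 1 := by
    intro a
    have := congrFun (congrFun (Unitary.coe_star_mul_self hX.eigenvectorUnitary) a) a
    rw [Matrix.one_apply_eq] at this
    simpa [Matrix.mul_apply, dotProduct, Matrix.star_apply] using this
  have hle : ∀ a, ((hX.eigenvectorUnitary : Matrix ι ι ℝ).col a ⬝ᵥ v) ^ 2 ≤ 1 := by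
    intro a
    have := Finset.sum_mul_sq_le_sq_mul_sq Finset.univ
      ((hX.eigenvectorUnitary : Matrix ι ι ℝ).col a) v
    have e1 := horth a
    simp only [dotProduct, ← sq] at e1 hv
    rw [e1, hv] at this
    simpa [dotProduct] using this
  rw [h4]
  simp only [Matrix.one_mulVec, horth, mul_one]
  calc Real.exp c * (1 + v ⬝ᵥ X *ᵥ v - c)
      = ∑ a, Real.exp c * (1 + hX.eigenvalues a - c) *
          ((hX.eigenvectorUnitary : Matrix ι ι ℝ).col a ⬝ᵥ v) ^ 2 := by
        rw [h2]
        calc _ = Real.exp c * (1 - c) * 1 + Real.exp c * ∑ a, id (hX.eigenvalues a) *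
              ((hX.eigenvectorUnitary : Matrix ι ι ℝ).col a ⬝ᵥ v) ^ 2 := by ring
          _ = _ := by
            rw [h1, Finset.mul_sum, Finset.mul_sum, ← Finset.sum_add_distrib]
            exact Finset.sum_congr rfl fun a _ => by simp only [id]; ring
    _ ≤ ∑ a, Real.exp (hX.eigenvalues a) *
          ((hX.eigenvectorUnitary : Matrix ι ι ℝ).col a ⬝ᵥ v) ^ 2 := by
        refine Finset.sum_le_sum fun a _ => mul_le_mul_of_nonneg_right ?_ (sq_nonneg _)
        have h := Real.add_one_le_exp (hX.eigenvalues a - c)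
        have e : Real.exp (hX.eigenvalues a) =
            Real.exp c * Real.exp (hX.eigenvalues a - c) := by rw [← Real.exp_add]; ring_nf
        rw [e]
        exact mul_le_mul_of_nonneg_left (by linarith) (Real.exp_pos _).le
    _ ≤ ∑ a, Real.exp (hX.eigenvalues a) :=
        Finset.sum_le_sum fun a _ => mul_le_of_le_one_right (Real.exp_pos _).le (hle a)

/-- One step of the matrix exponential moment bound: a random sign times `M`, compensated by an
upper bound `K` for `M²`, does not increase the trace exponential. -/
lemma trace_exp_add_trace_exp_le {S M K : Matrix ι ι ℝ} (hS : S.IsHermitian)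
    (hp : (S + (M - K)).IsHermitian) (hm : (S + (-M - K)).IsHermitian)
    (hK : ∀ v : ι → ℝ, v ⬝ᵥ (M * M) *ᵥ v ≤ v ⬝ᵥ K *ᵥ v) :
    (hp.cfc Real.exp).trace + (hm.cfc Real.exp).trace ≤ 2 * (hS.cfc Real.exp).trace := by
  have h1 := trace_exp_tangent_le hS hp
  have h2 := trace_exp_tangent_le hS hm
  have h3 := trace_sub_mul_exp_sub_exp_le hp hm
  have hQ : ∀ v : ι → ℝ, 0 ≤ v ⬝ᵥ (K - M * M) *ᵥ v := by
    intro v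
    rw [Matrix.sub_mulVec, dotProduct_sub]
    linarith [hK v]
  have h4 := trace_mul_exp_nonneg hp hQ
  have h5 := trace_mul_exp_nonneg hm hQ
  have e1 : S - (S + (M - K)) = K - M := by abel
  have e2 : S - (S + (-M - K)) = K + M := by abel
  have e3 : S + (M - K) - (S + (-M - K)) = (2 : ℝ) • M := by rw [two_smul]; abel
  rw [e1] at h1
  rw [e2] at h2
  rw [e3] at h3
  simp only [Matrix.sub_mul, Matrix.add_mul, Matrix.mul_add, Matrix.mul_sub, Matrix.smul_mul,
    Matrix.mul_smul, Matrix.trace_add, Matrix.trace_sub, Matrix.trace_smul, smul_eq_mul]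
    at h1 h2 h3 h4 h5
  linarith

end Matrix.IsHermitian

/-- The `±1` value of a bit. -/
def Bool.toSign (a : Bool) : ℝ := if a then 1 else -1

lemma Bool.toSign_mul_self (a : Bool) : a.toSign * a.toSign = 1 := by
  cases a <;> simp [Bool.toSign]

lemma Bool.abs_toSign (a : Bool) : |a.toSign| = 1 := by
  cases a <;> simp [Bool.toSign]

namespace Matrix

lemma isHermitian_sum {ι κ : Type*} (s : Finset κ) {A : κ → Matrix ι ι ℝ}
    (h : ∀ i, (A i).IsHermitian) : (∑ i ∈ s, A i).IsHermitian := by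
  rw [IsHermitian, conjTranspose_sum]
  exact Finset.sum_congr rfl fun i _ => h i

lemma IsHermitian.real_smul {ι : Type*} {A : Matrix ι ι ℝ} (h : A.IsHermitian) (c : ℝ) :
    (c • A).IsHermitian := by
  rw [IsHermitian, conjTranspose_smul, h.eq, star_trivial]

variable {ι : Type*} [Fintype ι] [DecidableEq ι]

/-- The trace exponential of a Rademacher series of symmetric matrices, compensated by upper
bounds for the squares, is on average at most its initial value. -/
lemma sum_trace_exp_rademacher_le (n : ℕ) (M K : Fin n → Matrix ι ι ℝ)
    (hM : ∀ i, (M i).IsHermitian) (hKh : ∀ i, (K i).IsHermitian)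
    (hK : ∀ i, ∀ v : ι → ℝ, v ⬝ᵥ (M i * M i) *ᵥ v ≤ v ⬝ᵥ K i *ᵥ v)
    (S : Matrix ι ι ℝ) (hS : S.IsHermitian) :
    ∑ x : Fin n → Bool, (cfc Real.exp (S + ∑ i, ((x i).toSign • M i - K i))).trace ≤
      2 ^ n * (cfc Real.exp S).trace := by
  induction n generalizing S with
  | zero => simp
  | succ n ih =>
    have step : ∀ a : Bool, (S + (a.toSign • M 0 - K 0)).IsHermitian := fun a =>
      hS.add (((hM 0).real_smul _).sub (hKh 0))
    have hp : (S + (M 0 - K 0)).IsHermitian := by simpa [Bool.toSign] using step true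
    have hm : (S + (-M 0 - K 0)).IsHermitian := by simpa [Bool.toSign] using step false
    have e : ∑ x : Fin (n + 1) → Bool,
        (cfc Real.exp (S + ∑ i, ((x i).toSign • M i - K i))).trace =
        ∑ a : Bool, ∑ x : Fin n → Bool, (cfc Real.exp (S + (a.toSign • M 0 - K 0) +
          ∑ i : Fin n, ((x i).toSign • M i.succ - K i.succ))).trace := by
      rw [← (Fin.consEquiv (fun _ => Bool)).sum_comp, Fintype.sum_prod_type]
      simp only [Fin.consEquiv, Equiv.coe_fn_mk, Fin.sum_univ_succ, Fin.cons_zero, Fin.cons_succ,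
        add_assoc]
    rw [e]
    calc _ ≤ ∑ a : Bool, 2 ^ n * (cfc Real.exp (S + (a.toSign • M 0 - K 0))).trace :=
          Finset.sum_le_sum fun a _ => ih (fun i => M i.succ) (fun i => K i.succ)
            (fun i => hM _) (fun i => hKh _) (fun i => hK _) _ (step a)
      _ = 2 ^ n * ((hp.cfc Real.exp).trace + (hm.cfc Real.exp).trace) := by
          rw [← hp.cfc_eq, ← hm.cfc_eq]
          simp [Bool.toSign]
          ring
      _ ≤ 2 ^ n * (2 * (hS.cfc Real.exp).trace) :=
          mul_le_mul_of_nonneg_left (IsHermitian.trace_exp_add_trace_exp_le hS hp hm (hK 0))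
            (by positivity)
      _ = _ := by rw [← hS.cfc_eq]; ring

/-- A dimension bound for families of vectors that correlate with a Rademacher series of
symmetric matrices. -/
lemma sum_le_log_card [Nonempty ι] (n : ℕ) (M K : Fin n → Matrix ι ι ℝ)
    (hM : ∀ i, (M i).IsHermitian) (hKh : ∀ i, (K i).IsHermitian)
    (hK : ∀ i, ∀ v : ι → ℝ, v ⬝ᵥ (M i * M i) *ᵥ v ≤ v ⬝ᵥ K i *ᵥ v)
    (v : (Fin n → Bool) → ι → ℝ) (hv : ∀ x, v x ⬝ᵥ v x = Fintype.card ι) :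
    ∑ x, ∑ i, ((x i).toSign * (v x ⬝ᵥ M i *ᵥ v x) - v x ⬝ᵥ K i *ᵥ v x) ≤
      2 ^ n * Fintype.card ι * Real.log (Fintype.card ι) := by
  have hN : (0 : ℝ) < Fintype.card ι := by exact_mod_cast Fintype.card_pos
  set N : ℝ := (Fintype.card ι : ℝ)
  set c : ℝ := (∑ x, ∑ i, ((x i).toSign * (v x ⬝ᵥ M i *ᵥ v x) - v x ⬝ᵥ K i *ᵥ v x)) / (2 ^ n * N)
    with hc
  have hle := sum_trace_exp_rademacher_le n M K hM hKh hK 0 isHermitian_zero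
  have h0 : (cfc Real.exp (0 : Matrix ι ι ℝ)).trace = N := by
    rw [cfc_apply_zero, Real.exp_zero, map_one, trace_one]
  rw [h0] at hle
  have hlow : ∀ x : Fin n → Bool, Real.exp c * (1 + (∑ i, ((x i).toSign * (v x ⬝ᵥ M i *ᵥ v x)
      - v x ⬝ᵥ K i *ᵥ v x)) / N - c) ≤
      (cfc Real.exp (0 + ∑ i, ((x i).toSign • M i - K i))).trace := by
    intro x
    have hh : (0 + ∑ i, ((x i).toSign • M i - K i)).IsHermitian :=
      isHermitian_zero.add (isHermitian_sum _ fun i => ((hM i).real_smul _).sub (hKh i))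
    have hs : (√N)⁻¹ * (√N)⁻¹ = N⁻¹ := by rw [← mul_inv, Real.mul_self_sqrt hN.le]
    have h1 : ((√N)⁻¹ • v x) ⬝ᵥ ((√N)⁻¹ • v x) = 1 := by
      rw [smul_dotProduct, dotProduct_smul, hv, smul_eq_mul, smul_eq_mul, ← mul_assoc, hs]
      exact inv_mul_cancel₀ hN.ne'
    have h2 := hh.le_trace_exp h1 c
    rw [← hh.cfc_eq] at h2
    convert h2 using 5
    rw [mulVec_smul, smul_dotProduct, dotProduct_smul, smul_eq_mul, smul_eq_mul, ← mul_assoc, hs,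
      zero_add, sum_mulVec, dotProduct_sum, div_eq_inv_mul]
    simp [sub_mulVec, smul_mulVec, dotProduct_sub]
  have hsum := (Finset.sum_le_sum fun x (_ : x ∈ Finset.univ) => hlow x).trans hle
  rw [← Finset.mul_sum, Finset.sum_sub_distrib, Finset.sum_add_distrib, ← Finset.sum_div] at hsum
  have hX : (∑ x, ∑ i, ((x i).toSign * (v x ⬝ᵥ M i *ᵥ v x) - v x ⬝ᵥ K i *ᵥ v x)) =
      c * (2 ^ n * N) := by
    rw [hc, div_mul_cancel₀]; positivity
  rw [hX] at hsum ⊢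
  simp only [Finset.sum_const, Finset.card_univ, Fintype.card_fun, Fintype.card_bool,
    Fintype.card_fin, nsmul_eq_mul, Nat.cast_pow, Nat.cast_ofNat] at hsum
  have e : (2 : ℝ) ^ n * 1 + c * (2 ^ n * N) / N - 2 ^ n * c = 2 ^ n := by
    field_simp; ring
  rw [e] at hsum
  have hexp : Real.exp c ≤ N := by
    have : (0 : ℝ) < 2 ^ n := by positivity
    nlinarith
  have := (Real.le_log_iff_exp_le hN).2 hexp
  calc c * (2 ^ n * N) = 2 ^ n * N * c := by ring
    _ ≤ _ := mul_le_mul_of_nonneg_left this (by positivity)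

end Matrix

/-- `ln 2` times the capacity of a binary symmetric channel is at most a chi-square distance. -/
lemma one_sub_binEnt_mul_log_two_le {η : ℝ} (h0 : 0 ≤ η) (h1 : η < 1 / 2) :
    (1 - binEnt (1 / 2 + η)) * Real.log 2 ≤ 4 * η ^ 2 := by
  have hl : 0 < Real.log 2 := Real.log_pos (by norm_num)
  have e : (1 - binEnt (1 / 2 + η)) * Real.log 2 =
      (1 / 2 + η) * Real.log (2 * (1 / 2 + η)) + (1 / 2 - η) * Real.log (2 * (1 / 2 - η)) := by
    rw [Real.log_mul (by norm_num) (by linarith), Real.log_mul (by norm_num) (by linarith)]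
    unfold binEnt Real.logb
    rw [show (1 : ℝ) - (1 / 2 + η) = 1 / 2 - η by ring]
    field_simp
    ring
  rw [e]
  have a := Real.log_le_sub_one_of_pos (x := 2 * (1 / 2 + η)) (by linarith)
  have c := Real.log_le_sub_one_of_pos (x := 2 * (1 / 2 - η)) (by linarith)
  nlinarith [mul_le_mul_of_nonneg_left a (show 0 ≤ 1 / 2 + η by linarith),
    mul_le_mul_of_nonneg_left c (show 0 ≤ 1 / 2 - η by linarith)]

/-- The character of the cube `{0,1}^ℓ` attached to a set of coordinates. -/
def cubeChar {ℓ : ℕ} (T : Finset (Fin ℓ)) (a : Fin ℓ → Bool) : ℝ := ∏ k ∈ T, (a k).toSign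

lemma cubeChar_mul_self {ℓ : ℕ} (T : Finset (Fin ℓ)) (a : Fin ℓ → Bool) :
    cubeChar T a * cubeChar T a = 1 := by
  rw [cubeChar, ← Finset.prod_mul_distrib]
  exact Finset.prod_eq_one fun k _ => Bool.toSign_mul_self _

lemma sum_cubeChar_mul_cubeChar {ℓ : ℕ} (T U : Finset (Fin ℓ)) :
    ∑ a, cubeChar T a * cubeChar U a = if T = U then 2 ^ ℓ else 0 := by
  have e : ∀ a : Fin ℓ → Bool, cubeChar T a * cubeChar U a =
      ∏ k, ((if k ∈ T then (a k).toSign else 1) * (if k ∈ U then (a k).toSign else 1)) := by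
    intro a
    rw [Finset.prod_mul_distrib]
    simp [cubeChar, Finset.prod_ite_mem]
  have e' := Fintype.prod_sum fun (k : Fin ℓ) (c : Bool) =>
    (if k ∈ T then c.toSign else 1) * (if k ∈ U then c.toSign else 1)
  rw [Finset.sum_congr rfl fun a _ => e a, ← e']
  split_ifs with h
  · subst h
    rw [Finset.prod_congr rfl (g := fun _ => (2 : ℝ))]
    · simp
    · intro k _
      by_cases hk : k ∈ T <;> (simp [hk, Bool.toSign]; try norm_num)
  · obtain ⟨k, hk⟩ : ∃ k, ¬ (k ∈ T ↔ k ∈ U) := by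
      by_contra hcon
      push Not at hcon
      exact h (Finset.ext hcon)
    refine Finset.prod_eq_zero (Finset.mem_univ k) ?_
    by_cases hT : k ∈ T <;> by_cases hU : k ∈ U <;> simp_all [Bool.toSign]

/-- Pairs of a position and a set of at most `b` answer bits. -/
abbrev ParityIndex (m ℓ b : ℕ) : Type := Fin m × {T : Finset (Fin ℓ) // T.card ≤ b}

namespace ParityIndex

open Matrix

variable {m ℓ b : ℕ}

lemma card_eq : Fintype.card (ParityIndex m ℓ b) =
    m * ∑ i ∈ Finset.range (b + 1), ℓ.choose i := by
  rw [Fintype.card_prod, Fintype.card_fin, Fintype.card_subtype]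
  congr 1
  rw [Finset.card_eq_sum_card_fiberwise (f := Finset.card) (t := Finset.range (b + 1))
    (by intro T hT; simp at hT ⊢; omega)]
  refine Finset.sum_congr rfl fun i hi => ?_
  rw [← Finset.card_fin ℓ, ← Finset.card_powersetCard, Finset.card_fin]
  congr 1
  ext T
  simp [Finset.mem_powersetCard] at hi ⊢
  omega

/-- The indices at position `j` whose answer bits lie in `S`. -/
def block (j : Fin m) (S : Finset (Fin ℓ)) : Finset (ParityIndex m ℓ b) :=
  Finset.univ.filter fun s => s.1 = j ∧ s.2.1 ⊆ S

lemma mem_block {j : Fin m} {S : Finset (Fin ℓ)} {s : ParityIndex m ℓ b} :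
    s ∈ block j S ↔ s.1 = j ∧ s.2.1 ⊆ S := by simp [block]

lemma card_block (j : Fin m) {S : Finset (Fin ℓ)} (hS : S.card = b) :
    (block j S : Finset (ParityIndex m ℓ b)).card = 2 ^ b := by
  rw [show 2 ^ b = S.powerset.card by rw [Finset.card_powerset, hS]]
  refine Finset.card_bij (fun s _ => s.2.1) ?_ ?_ ?_
  · intro s hs
    exact Finset.mem_powerset.2 (mem_block.1 hs).2
  · intro s hs t ht h
    exact Prod.ext ((mem_block.1 hs).1.trans (mem_block.1 ht).1.symm) (Subtype.ext h)
  · intro T hT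
    rw [Finset.mem_powerset] at hT
    exact ⟨(j, ⟨T, (Finset.card_le_card hT).trans hS.le⟩), mem_block.2 ⟨rfl, hT⟩, rfl⟩

/-- The characters evaluated at `a`, supported on a block. -/
def blockVec (j : Fin m) (S : Finset (Fin ℓ)) (a : Fin ℓ → Bool) (s : ParityIndex m ℓ b) : ℝ :=
  if s ∈ block j S then cubeChar s.2.1 a else 0

/-- The vector of all parities of at most `b` answer bits of a codeword. -/
def parityVec (c : Fin m → Fin ℓ → Bool) (s : ParityIndex m ℓ b) : ℝ := cubeChar s.2.1 (c s.1)

lemma blockVec_dotProduct (j : Fin m) (S : Finset (Fin ℓ)) (a : Fin ℓ → Bool)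
    (p : ParityIndex m ℓ b → ℝ) :
    blockVec j S a ⬝ᵥ p = ∑ s ∈ block j S, cubeChar s.2.1 a * p s := by
  simp [dotProduct, blockVec, Finset.sum_ite_mem]

/-- Parseval's identity on a block. -/
lemma sum_blockVec_dotProduct_sq (j : Fin m) (S : Finset (Fin ℓ)) (p : ParityIndex m ℓ b → ℝ) :
    ∑ a, (blockVec j S a ⬝ᵥ p) ^ 2 = 2 ^ ℓ * ∑ s ∈ block j S, p s ^ 2 := by
  simp only [blockVec_dotProduct, sq, Finset.sum_mul_sum]
  rw [Finset.sum_comm, Finset.mul_sum]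
  refine Finset.sum_congr rfl fun s hs => ?_
  rw [Finset.sum_comm]
  have e : ∀ t ∈ block j S, ∑ a, cubeChar s.2.1 a * p s * (cubeChar t.2.1 a * p t) =
      if s = t then 2 ^ ℓ * (p s * p s) else 0 := by
    intro t ht
    have : ∑ a, cubeChar s.2.1 a * p s * (cubeChar t.2.1 a * p t) =
        p s * p t * ∑ a, cubeChar s.2.1 a * cubeChar t.2.1 a := by
      rw [Finset.mul_sum]
      exact Finset.sum_congr rfl fun a _ => by ring
    rw [this, sum_cubeChar_mul_cubeChar]
    have hiff : s.2.1 = t.2.1 ↔ s = t := by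
      constructor
      · intro h
        exact Prod.ext ((mem_block.1 hs).1.trans (mem_block.1 ht).1.symm) (Subtype.ext h)
      · rintro rfl; rfl
    simp only [hiff]
    split_ifs with h
    · subst h; ring
    · ring
  rw [Finset.sum_congr rfl e, Finset.sum_ite_eq, if_pos hs]

lemma blockVec_dotProduct_parityVec_eq_prod (j : Fin m) {S : Finset (Fin ℓ)} (hS : S.card = b)
    (a : Fin ℓ → Bool) (c : Fin m → Fin ℓ → Bool) :
    blockVec j S a ⬝ᵥ (parityVec c : ParityIndex m ℓ b → ℝ) =
      ∏ k ∈ S, (1 + (a k).toSign * (c j k).toSign) := by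
  rw [blockVec_dotProduct, Finset.prod_one_add]
  refine Finset.sum_bij (fun s _ => s.2.1) ?_ ?_ ?_ ?_
  · intro s hs
    exact Finset.mem_powerset.2 (mem_block.1 hs).2
  · intro s hs t ht h
    exact Prod.ext ((mem_block.1 hs).1.trans (mem_block.1 ht).1.symm) (Subtype.ext h)
  · intro T hT
    rw [Finset.mem_powerset] at hT
    exact ⟨(j, ⟨T, (Finset.card_le_card hT).trans hS.le⟩), mem_block.2 ⟨rfl, hT⟩, rfl⟩
  · intro s hs
    rw [parityVec, (mem_block.1 hs).1, cubeChar, cubeChar, Finset.prod_mul_distrib]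

lemma eq_of_blockVec_dotProduct_parityVec_ne_zero {j : Fin m} {S : Finset (Fin ℓ)}
    (hS : S.card = b) {a : Fin ℓ → Bool} {c : Fin m → Fin ℓ → Bool}
    (h : blockVec j S a ⬝ᵥ (parityVec c : ParityIndex m ℓ b → ℝ) ≠ 0) : ∀ k ∈ S, a k = c j k := by
  rw [blockVec_dotProduct_parityVec_eq_prod j hS, Finset.prod_ne_zero_iff] at h
  intro k hk
  have := h k hk
  revert this
  cases a k <;> cases c j k <;> simp [Bool.toSign]

lemma sum_blockVec_dotProduct_parityVec (j : Fin m) (S : Finset (Fin ℓ))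
    (c : Fin m → Fin ℓ → Bool) :
    ∑ a, blockVec j S a ⬝ᵥ (parityVec c : ParityIndex m ℓ b → ℝ) = 2 ^ ℓ := by
  simp only [blockVec_dotProduct]
  rw [Finset.sum_comm]
  have hmem : ((j, ⟨∅, by simp⟩) : ParityIndex m ℓ b) ∈ block j S := by simp [mem_block]
  have e : ∀ s ∈ (block j S : Finset (ParityIndex m ℓ b)),
      ∑ a, cubeChar s.2.1 a * parityVec c s = if s = (j, ⟨∅, by simp⟩) then 2 ^ ℓ else 0 := by
    intro s hs
    rw [← Finset.sum_mul]
    have := sum_cubeChar_mul_cubeChar s.2.1 ∅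
    simp only [show ∀ a : Fin ℓ → Bool, cubeChar ∅ a = 1 from fun a => rfl, mul_one] at this
    rw [this]
    have hiff : s.2.1 = ∅ ↔ s = (j, ⟨∅, by simp⟩) := by
      constructor
      · intro h
        exact Prod.ext (mem_block.1 hs).1 (Subtype.ext h)
      · rintro rfl; rfl
    simp only [hiff]
    split_ifs with h
    · subst h; simp [parityVec, cubeChar]
    · ring
  rw [Finset.sum_congr rfl e, Finset.sum_ite_eq' , if_pos hmem]

lemma sum_block_parityVec_sq (j : Fin m) {S : Finset (Fin ℓ)} (hS : S.card = b)
    (c : Fin m → Fin ℓ → Bool) :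
    ∑ s ∈ (block j S : Finset (ParityIndex m ℓ b)), parityVec c s ^ 2 = 2 ^ b := by
  rw [Finset.sum_congr rfl (g := fun _ => (1 : ℝ))]
  · rw [Finset.sum_const, card_block j hS]
    simp
  · intro s _
    rw [sq, parityVec, cubeChar_mul_self]

lemma parityVec_dotProduct_self (c : Fin m → Fin ℓ → Bool) :
    (parityVec c : ParityIndex m ℓ b → ℝ) ⬝ᵥ parityVec c =
      Fintype.card (ParityIndex m ℓ b) := by
  simp [dotProduct, parityVec, cubeChar_mul_self]

/-- A function of the answer bits at one position is read off from the parities by an observable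
of norm at most one supported on one block. -/
lemma exists_observable_of_one_block (hb : 1 ≤ b) (j : Fin m) {S : Finset (Fin ℓ)}
    (hS : S.card = b) (F : (Fin ℓ → Bool) → ℝ) (hF1 : ∀ a, |F a| ≤ 1)
    (hF : ∀ a a', (∀ k ∈ S, a k = a' k) → F a = F a') :
    ∃ O : Matrix (ParityIndex m ℓ b) (ParityIndex m ℓ b) ℝ, O.IsHermitian ∧
      (∀ p q : ParityIndex m ℓ b → ℝ, 2 * (p ⬝ᵥ O *ᵥ q) ≤ ∑ s ∈ block j S, (p s ^ 2 + q s ^ 2)) ∧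
      ∀ c : Fin m → Fin ℓ → Bool, parityVec c ⬝ᵥ O *ᵥ parityVec c = 2 * F (c j) := by
  have hform : ∀ p q : ParityIndex m ℓ b → ℝ,
      p ⬝ᵥ ((2 / (2 ^ b * 2 ^ ℓ) : ℝ) • ∑ a, F a • vecMulVec (blockVec j S a) (blockVec j S a)) *ᵥ q
      = 2 / (2 ^ b * 2 ^ ℓ) *
        ∑ a, F a * ((blockVec j S a ⬝ᵥ p) * (blockVec j S a ⬝ᵥ q)) := by
    intro p q
    rw [smul_mulVec, dotProduct_smul, sum_mulVec, dotProduct_sum, smul_eq_mul]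
    congr 1
    refine Finset.sum_congr rfl fun a _ => ?_
    rw [smul_mulVec, dotProduct_smul, smul_eq_mul, vecMulVec_mulVec, dotProduct_smul,
      dotProduct_comm p]
    simp
  refine ⟨(2 / (2 ^ b * 2 ^ ℓ) : ℝ) • ∑ a, F a • vecMulVec (blockVec j S a) (blockVec j S a),
    ?_, ?_, ?_⟩
  · refine IsHermitian.real_smul (isHermitian_sum _ fun a => IsHermitian.real_smul ?_ _) _
    rw [IsHermitian, conjTranspose_vecMulVec, star_trivial]
  · intro p q
    rw [hform]
    have hP := sum_blockVec_dotProduct_sq j S p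
    have hQ := sum_blockVec_dotProduct_sq j S q
    have hle : 2 * ∑ a, F a * ((blockVec j S a ⬝ᵥ p) * (blockVec j S a ⬝ᵥ q)) ≤
        ∑ a, (blockVec j S a ⬝ᵥ p) ^ 2 + ∑ a, (blockVec j S a ⬝ᵥ q) ^ 2 := by
      rw [Finset.mul_sum, ← Finset.sum_add_distrib]
      refine Finset.sum_le_sum fun a _ => ?_
      obtain ⟨h1, h2⟩ := abs_le.1 (hF1 a)
      nlinarith [mul_nonneg (sub_nonneg.2 h2) (sq_nonneg ((blockVec j S a ⬝ᵥ p) -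
          (blockVec j S a ⬝ᵥ q))), mul_nonneg (by linarith : 0 ≤ 1 + F a)
          (sq_nonneg ((blockVec j S a ⬝ᵥ p) - (blockVec j S a ⬝ᵥ q))),
        mul_nonneg (sub_nonneg.2 h2) (sq_nonneg ((blockVec j S a ⬝ᵥ p) +
          (blockVec j S a ⬝ᵥ q)))]
    rw [hP, hQ, ← mul_add, ← Finset.sum_add_distrib] at hle
    have hnn : 0 ≤ ∑ s ∈ block j S, (p s ^ 2 + q s ^ 2) :=
      Finset.sum_nonneg fun s _ => by positivity
    have hb2 : (2 : ℝ) ≤ 2 ^ b := by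
      calc (2 : ℝ) = 2 ^ 1 := (pow_one _).symm
        _ ≤ 2 ^ b := pow_le_pow_right₀ (by norm_num) hb
    calc 2 * (2 / (2 ^ b * 2 ^ ℓ) *
          ∑ a, F a * ((blockVec j S a ⬝ᵥ p) * (blockVec j S a ⬝ᵥ q)))
        = 2 / (2 ^ b * 2 ^ ℓ) *
          (2 * ∑ a, F a * ((blockVec j S a ⬝ᵥ p) * (blockVec j S a ⬝ᵥ q))) := by ring
      _ ≤ 2 / (2 ^ b * 2 ^ ℓ) * (2 ^ ℓ * ∑ s ∈ block j S, (p s ^ 2 + q s ^ 2)) :=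
          mul_le_mul_of_nonneg_left hle (by positivity)
      _ = 2 / 2 ^ b * ∑ s ∈ block j S, (p s ^ 2 + q s ^ 2) := by field_simp
      _ ≤ 1 * ∑ s ∈ block j S, (p s ^ 2 + q s ^ 2) := by
          refine mul_le_mul_of_nonneg_right ?_ hnn
          rw [div_le_one (by positivity)]
          exact hb2
      _ = _ := one_mul _
  · intro c
    rw [hform]
    have e : ∀ a, F a * ((blockVec j S a ⬝ᵥ (parityVec c : ParityIndex m ℓ b → ℝ)) *
        (blockVec j S a ⬝ᵥ (parityVec c : ParityIndex m ℓ b → ℝ))) =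
        F (c j) * (blockVec j S a ⬝ᵥ (parityVec c : ParityIndex m ℓ b → ℝ)) ^ 2 := by
      intro a
      by_cases h : blockVec j S a ⬝ᵥ (parityVec c : ParityIndex m ℓ b → ℝ) = 0
      · simp [h]
      · rw [hF a (c j) (eq_of_blockVec_dotProduct_parityVec_ne_zero hS h), sq]
    rw [Finset.sum_congr rfl fun a _ => e a, ← Finset.mul_sum, sum_blockVec_dotProduct_sq,
      sum_block_parityVec_sq j hS]
    field_simp

/-- A function of the answer bits at two positions is correlated with the parities through an
observable of norm at most one that exchanges two blocks. -/
lemma exists_observable_of_two_blocks {j₀ j₁ : Fin m} (hj : j₀ ≠ j₁) {S₀ S₁ : Finset (Fin ℓ)}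
    (hS₀ : S₀.card = b) (hS₁ : S₁.card = b) (F : (Fin ℓ → Bool) → (Fin ℓ → Bool) → ℝ)
    (hF1 : ∀ a a', |F a a'| ≤ 1)
    (hF : ∀ a a' d d', (∀ k ∈ S₀, a k = d k) → (∀ k ∈ S₁, a' k = d' k) → F a a' = F d d') :
    ∃ O : Matrix (ParityIndex m ℓ b) (ParityIndex m ℓ b) ℝ, O.IsHermitian ∧
      (∀ p q : ParityIndex m ℓ b → ℝ,
        2 * (p ⬝ᵥ O *ᵥ q) ≤ ∑ s ∈ block j₀ S₀ ∪ block j₁ S₁, (p s ^ 2 + q s ^ 2)) ∧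
      ∀ c : Fin m → Fin ℓ → Bool, parityVec c ⬝ᵥ O *ᵥ parityVec c = 2 * F (c j₀) (c j₁) := by
  have hform : ∀ p q : ParityIndex m ℓ b → ℝ,
      p ⬝ᵥ ((1 / (2 ^ ℓ * 2 ^ ℓ) : ℝ) • ∑ a, ∑ a', F a a' •
        (vecMulVec (blockVec j₀ S₀ a) (blockVec j₁ S₁ a') +
          vecMulVec (blockVec j₁ S₁ a') (blockVec j₀ S₀ a))) *ᵥ q
      = 1 / (2 ^ ℓ * 2 ^ ℓ) * ∑ a, ∑ a', F a a' *
        ((blockVec j₀ S₀ a ⬝ᵥ p) * (blockVec j₁ S₁ a' ⬝ᵥ q) +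
          (blockVec j₁ S₁ a' ⬝ᵥ p) * (blockVec j₀ S₀ a ⬝ᵥ q)) := by
    intro p q
    rw [smul_mulVec, dotProduct_smul, sum_mulVec, dotProduct_sum, smul_eq_mul]
    congr 1
    refine Finset.sum_congr rfl fun a _ => ?_
    rw [sum_mulVec, dotProduct_sum]
    refine Finset.sum_congr rfl fun a' _ => ?_
    rw [smul_mulVec, dotProduct_smul, smul_eq_mul, add_mulVec, dotProduct_add,
      vecMulVec_mulVec, vecMulVec_mulVec, dotProduct_smul, dotProduct_smul, dotProduct_comm p,
      dotProduct_comm p]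
    simp [mul_comm]
  refine ⟨(1 / (2 ^ ℓ * 2 ^ ℓ) : ℝ) • ∑ a, ∑ a', F a a' •
    (vecMulVec (blockVec j₀ S₀ a) (blockVec j₁ S₁ a') +
      vecMulVec (blockVec j₁ S₁ a') (blockVec j₀ S₀ a)), ?_, fun p q => ?_, fun c => ?_⟩
  · refine IsHermitian.real_smul (isHermitian_sum _ fun a => isHermitian_sum _ fun a' =>
      IsHermitian.real_smul ?_ _) _
    rw [IsHermitian, conjTranspose_add, conjTranspose_vecMulVec, conjTranspose_vecMulVec,
      star_trivial, star_trivial, add_comm]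
  · rw [hform]
    have hdisj : Disjoint (block j₀ S₀ : Finset (ParityIndex m ℓ b)) (block j₁ S₁) := by
      rw [Finset.disjoint_left]
      intro s hs ht
      exact hj ((mem_block.1 hs).1.symm.trans (mem_block.1 ht).1)
    have hle : 2 * ∑ a, ∑ a', F a a' *
        ((blockVec j₀ S₀ a ⬝ᵥ p) * (blockVec j₁ S₁ a' ⬝ᵥ q) +
          (blockVec j₁ S₁ a' ⬝ᵥ p) * (blockVec j₀ S₀ a ⬝ᵥ q)) ≤
        ∑ a : Fin ℓ → Bool, ∑ a' : Fin ℓ → Bool,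
          (((blockVec j₀ S₀ a ⬝ᵥ p) ^ 2 + (blockVec j₀ S₀ a ⬝ᵥ q) ^ 2) +
          ((blockVec j₁ S₁ a' ⬝ᵥ p) ^ 2 + (blockVec j₁ S₁ a' ⬝ᵥ q) ^ 2)) := by
      simp only [Finset.mul_sum]
      refine Finset.sum_le_sum fun a _ => Finset.sum_le_sum fun a' _ => ?_
      have h : ∀ f s t : ℝ, |f| ≤ 1 → 2 * (f * (s * t)) ≤ s ^ 2 + t ^ 2 := by
        intro f s t hf
        obtain ⟨h1, h2⟩ := abs_le.1 hf
        nlinarith [mul_nonneg (sub_nonneg.2 h2) (sq_nonneg (s + t)),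
          mul_nonneg (by linarith : 0 ≤ 1 + f) (sq_nonneg (s - t))]
      have h1 := h _ (blockVec j₀ S₀ a ⬝ᵥ p) (blockVec j₁ S₁ a' ⬝ᵥ q) (hF1 a a')
      have h2 := h _ (blockVec j₁ S₁ a' ⬝ᵥ p) (blockVec j₀ S₀ a ⬝ᵥ q) (hF1 a a')
      linarith
    simp only [Finset.sum_add_distrib, Finset.sum_const, Finset.card_univ, Fintype.card_fun,
      Fintype.card_bool, Fintype.card_fin, nsmul_eq_mul, ← Finset.mul_sum, Nat.cast_pow,
      Nat.cast_ofNat, sum_blockVec_dotProduct_sq] at hle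
    rw [Finset.sum_union hdisj]
    simp only [Finset.sum_add_distrib]
    rw [← mul_assoc, mul_comm (2 : ℝ), mul_assoc, one_div, inv_mul_le_iff₀ (by positivity)]
    linarith
  · rw [hform]
    have e : ∀ a a', F a a' *
        ((blockVec j₀ S₀ a ⬝ᵥ (parityVec c : ParityIndex m ℓ b → ℝ)) *
            (blockVec j₁ S₁ a' ⬝ᵥ (parityVec c : ParityIndex m ℓ b → ℝ)) +
          (blockVec j₁ S₁ a' ⬝ᵥ (parityVec c : ParityIndex m ℓ b → ℝ)) *
            (blockVec j₀ S₀ a ⬝ᵥ (parityVec c : ParityIndex m ℓ b → ℝ))) =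
        2 * F (c j₀) (c j₁) * ((blockVec j₀ S₀ a ⬝ᵥ (parityVec c : ParityIndex m ℓ b → ℝ)) *
          (blockVec j₁ S₁ a' ⬝ᵥ (parityVec c : ParityIndex m ℓ b → ℝ))) := by
      intro a a'
      by_cases h : blockVec j₀ S₀ a ⬝ᵥ (parityVec c : ParityIndex m ℓ b → ℝ) = 0
      · simp [h]
      by_cases h' : blockVec j₁ S₁ a' ⬝ᵥ (parityVec c : ParityIndex m ℓ b → ℝ) = 0
      · simp [h']
      rw [hF a a' _ _ (eq_of_blockVec_dotProduct_parityVec_ne_zero hS₀ h)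
        (eq_of_blockVec_dotProduct_parityVec_ne_zero hS₁ h')]
      ring
    rw [Finset.sum_congr rfl fun a _ => Finset.sum_congr rfl fun a' _ => e a a']
    simp only [← Finset.mul_sum]
    rw [← Finset.sum_mul, sum_blockVec_dotProduct_parityVec, sum_blockVec_dotProduct_parityVec]
    field_simp

/-- The codeword with the positions in `B` erased. -/
def erase (B : Finset (Fin m)) (c : Fin m → Fin ℓ → Bool) (j : Fin m) : Fin ℓ → Bool :=
  if j ∈ B then fun _ => false else c j

/-- The decision of a decoding tuple on a partly erased codeword is, up to a constant, the value
of an observable supported on the blocks queried outside the erased positions. -/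
lemma exists_observable_of_valid (hb : 1 ≤ b) {ω : DecTuple m ℓ} (hω : ω.Valid b)
    (B : Finset (Fin m)) :
    ∃ (O : Matrix (ParityIndex m ℓ b) (ParityIndex m ℓ b) ℝ) (R : Finset (ParityIndex m ℓ b))
      (α : ℝ), O.IsHermitian ∧
      (∀ p q : ParityIndex m ℓ b → ℝ, 2 * (p ⬝ᵥ O *ᵥ q) ≤ ∑ s ∈ R, (p s ^ 2 + q s ^ 2)) ∧
      (∀ c : Fin m → Fin ℓ → Bool, parityVec c ⬝ᵥ O *ᵥ parityVec c =
        2 * (ω.f (erase B c ω.j0) (erase B c ω.j1)).toSign - α) ∧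
      (∀ s ∈ R, (ω.j0 = s.1 ∨ ω.j1 = s.1) ∧ s.1 ∉ B) ∧ R.card ≤ 2 * 2 ^ b := by
  obtain ⟨hj, hS₀, hS₁, hf⟩ := hω
  by_cases h0 : ω.j0 ∈ B <;> by_cases h1 : ω.j1 ∈ B
  · refine ⟨0, ∅, 2 * (ω.f (fun _ => false) fun _ => false).toSign, isHermitian_zero, ?_, ?_, ?_,
      ?_⟩
    · simp
    · simp [erase, h0, h1]
    · simp
    · simp
  · obtain ⟨O, hO, hle, hval⟩ := exists_observable_of_one_block hb ω.j1 hS₁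
      (fun a => (ω.f (fun _ => false) a).toSign) (fun a => (Bool.abs_toSign _).le)
      (fun a a' h => congrArg _ (hf _ _ _ _ (fun _ _ => rfl) h))
    refine ⟨O, block ω.j1 ω.S1, 0, hO, hle, fun c => ?_, fun s hs => ?_, ?_⟩
    · rw [hval]; simp [erase, h0, h1]
    · rw [(mem_block.1 hs).1]; exact ⟨Or.inr rfl, h1⟩
    · rw [card_block _ hS₁]; omega
  · obtain ⟨O, hO, hle, hval⟩ := exists_observable_of_one_block hb ω.j0 hS₀
      (fun a => (ω.f a (fun _ => false)).toSign) (fun a => (Bool.abs_toSign _).le)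
      (fun a a' h => congrArg _ (hf _ _ _ _ h (fun _ _ => rfl)))
    refine ⟨O, block ω.j0 ω.S0, 0, hO, hle, fun c => ?_, fun s hs => ?_, ?_⟩
    · rw [hval]; simp [erase, h0, h1]
    · rw [(mem_block.1 hs).1]; exact ⟨Or.inl rfl, h0⟩
    · rw [card_block _ hS₀]; omega
  · obtain ⟨O, hO, hle, hval⟩ := exists_observable_of_two_blocks hj hS₀ hS₁
      (fun a a' => (ω.f a a').toSign) (fun a a' => (Bool.abs_toSign _).le)
      (fun a a' d d' h h' => congrArg _ (hf _ _ _ _ h h'))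
    refine ⟨O, block ω.j0 ω.S0 ∪ block ω.j1 ω.S1, 0, hO, hle, fun c => ?_, fun s hs => ?_, ?_⟩
    · rw [hval]; simp [erase, h0, h1]
    · rcases Finset.mem_union.1 hs with h | h
      · rw [(mem_block.1 h).1]; exact ⟨Or.inl rfl, h0⟩
      · rw [(mem_block.1 h).1]; exact ⟨Or.inr rfl, h1⟩
    · refine (Finset.card_union_le _ _).trans ?_
      rw [card_block _ hS₀, card_block _ hS₁]; omega

end ParityIndex

namespace IsLDCDecoder

open Matrix ParityIndex

variable {n m ℓ b : ℕ} {δ ε : ℝ} {C : (Fin n → Bool) → Fin m → Fin ℓ → Bool} {i : Fin n}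
  {D : DecTuple m ℓ → ℝ}

lemma half_add_le_one (h : IsLDCDecoder b δ ε C i D) (hδ : 0 ≤ δ) : 1 / 2 + ε ≤ 1 := by
  obtain ⟨hD0, hD1, -, hdec⟩ := h
  refine (hdec (fun _ => false) (C fun _ => false) (by simp; positivity)).trans ?_
  rw [← hD1]
  exact Finset.sum_le_sum_of_subset_of_nonneg (Finset.subset_univ _) fun ω _ _ => hD0 ω

lemma one_le_bits (h : IsLDCDecoder b δ ε C i D) (hδ : 0 ≤ δ) (hε : 0 < ε) : 1 ≤ b := by
  obtain ⟨hD0, hD1, hval, hdec⟩ := h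
  by_contra hb
  obtain rfl : b = 0 := by omega
  have h1 := hdec (fun _ => false) (C fun _ => false) (by simp; positivity)
  have h2 := hdec (fun _ => true) (C fun _ => true) (by simp; positivity)
  rw [Finset.sum_filter] at h1 h2
  have hle := add_le_add h1 h2
  rw [← Finset.sum_add_distrib] at hle
  have : ∀ ω, ((if ω.f (C (fun _ => false) ω.j0) (C (fun _ => false) ω.j1) = false then D ω else 0) +
      if ω.f (C (fun _ => true) ω.j0) (C (fun _ => true) ω.j1) = true then D ω else 0) ≤ D ω := by
    intro ω
    by_cases hω : D ω = 0
    · simp [hω]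
    obtain ⟨-, hS₀, hS₁, hf⟩ := hval ω hω
    rw [Finset.card_eq_zero] at hS₀ hS₁
    rw [hf _ _ (C (fun _ => true) ω.j0) (C (fun _ => true) ω.j1) (by simp [hS₀]) (by simp [hS₁])]
    cases ω.f (C (fun _ => true) ω.j0) (C (fun _ => true) ω.j1) <;> simp
  have h3 := Finset.sum_le_sum fun ω (_ : ω ∈ Finset.univ) => this ω
  rw [hD1] at h3
  linarith

/-- Only few positions are queried with large probability. -/
lemma card_often_queried_le (h : IsLDCDecoder b δ ε C i D) (hδ : 0 < δ) (hm : 0 < m) :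
    ((Finset.univ.filter fun j : Fin m => 2 / (δ * m) <
      ∑ ω ∈ Finset.univ.filter (fun ω : DecTuple m ℓ => ω.j0 = j ∨ ω.j1 = j), D ω).card : ℝ) ≤
      δ * m := by
  obtain ⟨hD0, hD1, -, -⟩ := h
  set B := Finset.univ.filter fun j : Fin m => 2 / (δ * m) <
    ∑ ω ∈ Finset.univ.filter (fun ω : DecTuple m ℓ => ω.j0 = j ∨ ω.j1 = j), D ω with hB
  have hm' : (0 : ℝ) < m := by exact_mod_cast hm
  have h1 : B.card * (2 / (δ * m)) ≤
      ∑ j, ∑ ω ∈ Finset.univ.filter (fun ω : DecTuple m ℓ => ω.j0 = j ∨ ω.j1 = j), D ω := by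
    rw [← nsmul_eq_mul, ← Finset.sum_const]
    refine (Finset.sum_le_sum fun j hj => ?_).trans (Finset.sum_le_sum_of_subset_of_nonneg
      (Finset.subset_univ B) fun j _ _ => Finset.sum_nonneg fun ω _ => hD0 ω)
    exact (Finset.mem_filter.1 hj).2.le
  have h2 : ∑ j, ∑ ω ∈ Finset.univ.filter (fun ω : DecTuple m ℓ => ω.j0 = j ∨ ω.j1 = j), D ω ≤
      2 := by
    simp only [Finset.sum_filter]
    rw [Finset.sum_comm]
    calc _ ≤ ∑ ω : DecTuple m ℓ, ∑ j, ((if ω.j0 = j then D ω else 0) +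
            if ω.j1 = j then D ω else 0) := by
          refine Finset.sum_le_sum fun ω _ => Finset.sum_le_sum fun j _ => ?_
          have := hD0 ω
          split_ifs <;> simp_all
      _ = 2 := by simp [Finset.sum_add_distrib, hD1]; norm_num
  have h3 := h1.trans h2
  rw [mul_div_assoc', div_le_iff₀ (by positivity)] at h3
  linarith

/-- A decoder yields a symmetric matrix whose values at the parity vectors are correlated with the
decoded bit, together with a diagonal bound for its square. -/
lemma exists_matrices (h : IsLDCDecoder b δ ε C i D) (hδ : 0 < δ) (hb : 1 ≤ b) (hm : 0 < m) :
    ∃ M K : Matrix (ParityIndex m ℓ b) (ParityIndex m ℓ b) ℝ, M.IsHermitian ∧ K.IsHermitian ∧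
      (∀ v : ParityIndex m ℓ b → ℝ, v ⬝ᵥ (M * M) *ᵥ v ≤ v ⬝ᵥ K *ᵥ v) ∧
      2 ^ n * (2 * ε * (m * δ)) ≤
        ∑ x, (x i).toSign * (parityVec (C x) ⬝ᵥ M *ᵥ parityVec (C x)) ∧
      ∀ x, parityVec (C x) ⬝ᵥ K *ᵥ parityVec (C x) ≤ m * δ * 2 ^ b := by
  have hcard := h.card_often_queried_le hδ hm
  obtain ⟨hD0, hD1, hval, hdec⟩ := h
  set B := Finset.univ.filter fun j : Fin m => 2 / (δ * m) <
    ∑ ω ∈ Finset.univ.filter (fun ω : DecTuple m ℓ => ω.j0 = j ∨ ω.j1 = j), D ω with hB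
  have hm' : (0 : ℝ) < m := by exact_mod_cast hm
  have hex : ∀ ω : DecTuple m ℓ, ∃ (O : Matrix (ParityIndex m ℓ b) (ParityIndex m ℓ b) ℝ)
      (R : Finset (ParityIndex m ℓ b)) (α : ℝ), O.IsHermitian ∧
      (∀ p q : ParityIndex m ℓ b → ℝ, 2 * (p ⬝ᵥ O *ᵥ q) ≤ ∑ s ∈ R, (p s ^ 2 + q s ^ 2)) ∧
      (∀ c : Fin m → Fin ℓ → Bool, D ω * (parityVec c ⬝ᵥ O *ᵥ parityVec c) =
        D ω * (2 * (ω.f (erase B c ω.j0) (erase B c ω.j1)).toSign - α)) ∧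
      (∀ s ∈ R, (ω.j0 = s.1 ∨ ω.j1 = s.1) ∧ s.1 ∉ B) ∧ R.card ≤ 2 * 2 ^ b := by
    intro ω
    by_cases hω : D ω = 0
    · exact ⟨0, ∅, 0, isHermitian_zero, by simp, by simp [hω], by simp, by simp⟩
    · obtain ⟨O, R, α, h1, h2, h3, h4, h5⟩ := exists_observable_of_valid hb (hval ω hω) B
      exact ⟨O, R, α, h1, h2, fun c => by rw [h3], h4, h5⟩
  choose O R α hO hle hobs hR hRcard using hex
  have hq : ∀ ω, 0 ≤ D ω * (m * δ / 2) := fun ω => mul_nonneg (hD0 ω) (by positivity)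
  set k : ParityIndex m ℓ b → ℝ := fun s => ∑ ω, if s ∈ R ω then D ω * (m * δ / 2) else 0 with hk
  have hk1 : ∀ s, k s ≤ 1 := by
    intro s
    by_cases hs : s.1 ∈ B
    · have : k s = 0 := Finset.sum_eq_zero fun ω _ => if_neg fun hsR => (hR ω s hsR).2 hs
      rw [this]; exact zero_le_one
    · have hs' : ∑ ω ∈ Finset.univ.filter (fun ω : DecTuple m ℓ => ω.j0 = s.1 ∨ ω.j1 = s.1),
          D ω ≤ 2 / (δ * m) := by
        by_contra hcon
        exact hs (Finset.mem_filter.2 ⟨Finset.mem_univ _, not_le.1 hcon⟩)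
      calc k s ≤ ∑ ω : DecTuple m ℓ, (if ω.j0 = s.1 ∨ ω.j1 = s.1 then D ω else 0) * (m * δ / 2) := by
            refine Finset.sum_le_sum fun ω _ => ?_
            by_cases hsR : s ∈ R ω
            · rw [if_pos hsR, if_pos (hR ω s hsR).1]
            · rw [if_neg hsR]
              split_ifs
              · exact hq ω
              · simp
        _ = (∑ ω ∈ Finset.univ.filter (fun ω : DecTuple m ℓ => ω.j0 = s.1 ∨ ω.j1 = s.1), D ω) *
              (m * δ / 2) := by rw [← Finset.sum_mul, Finset.sum_filter]
        _ ≤ 2 / (δ * m) * (m * δ / 2) := mul_le_mul_of_nonneg_right hs' (by positivity)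
        _ = 1 := by field_simp
  have hM : (∑ ω, (D ω * (m * δ / 2)) • O ω).IsHermitian :=
    isHermitian_sum _ fun ω => (hO ω).real_smul _
  have hform : ∀ p q : ParityIndex m ℓ b → ℝ, p ⬝ᵥ (∑ ω, (D ω * (m * δ / 2)) • O ω) *ᵥ q =
      ∑ ω, D ω * (m * δ / 2) * (p ⬝ᵥ O ω *ᵥ q) := by
    intro p q
    rw [sum_mulVec, dotProduct_sum]
    refine Finset.sum_congr rfl fun ω _ => ?_
    rw [smul_mulVec, dotProduct_smul, smul_eq_mul]
  have hKform : ∀ p : ParityIndex m ℓ b → ℝ, p ⬝ᵥ diagonal k *ᵥ p = ∑ s, k s * p s ^ 2 := by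
    intro p
    simp only [dotProduct, mulVec_diagonal]
    exact Finset.sum_congr rfl fun s _ => by ring
  have hswap : ∀ g : ParityIndex m ℓ b → ℝ,
      ∑ ω, D ω * (m * δ / 2) * ∑ s ∈ R ω, g s = ∑ s, k s * g s := by
    intro g
    simp only [hk, Finset.sum_mul, Finset.mul_sum]
    rw [Finset.sum_comm]
    refine Finset.sum_congr rfl fun ω _ => ?_
    simp [ite_mul, Finset.sum_ite_mem]
  have hbound : ∀ p q : ParityIndex m ℓ b → ℝ,
      2 * (p ⬝ᵥ (∑ ω, (D ω * (m * δ / 2)) • O ω) *ᵥ q) ≤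
        p ⬝ᵥ p + q ⬝ᵥ diagonal k *ᵥ q := by
    intro p q
    calc _ = ∑ ω, D ω * (m * δ / 2) * (2 * (p ⬝ᵥ O ω *ᵥ q)) := by
          rw [hform, Finset.mul_sum]
          exact Finset.sum_congr rfl fun ω _ => by ring
      _ ≤ ∑ ω, D ω * (m * δ / 2) * ∑ s ∈ R ω, (p s ^ 2 + q s ^ 2) :=
          Finset.sum_le_sum fun ω _ => mul_le_mul_of_nonneg_left (hle ω p q) (hq ω)
      _ = ∑ s, k s * p s ^ 2 + ∑ s, k s * q s ^ 2 := by
          rw [hswap, ← Finset.sum_add_distrib]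
          exact Finset.sum_congr rfl fun s _ => by ring
      _ ≤ _ := by
          rw [hKform]
          gcongr
          refine Finset.sum_le_sum fun s _ => ?_
          nlinarith [hk1 s, sq_nonneg (p s)]
  refine ⟨∑ ω, (D ω * (m * δ / 2)) • O ω, diagonal k, hM, isHermitian_diagonal k, ?_, ?_, ?_⟩
  · intro v
    set M := ∑ ω, (D ω * (m * δ / 2)) • O ω
    have hMM : v ⬝ᵥ (M * M) *ᵥ v = (M *ᵥ v) ⬝ᵥ (M *ᵥ v) := by
      rw [← mulVec_mulVec, dotProduct_mulVec, ← mulVec_transpose,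
        ← conjTranspose_eq_transpose_of_trivial, hM.eq]
    have := hbound (M *ᵥ v) v
    rw [hMM]
    linarith
  · have hadv : ∀ x, 2 * ε ≤ (x i).toSign *
        ∑ ω, D ω * (ω.f (erase B (C x) ω.j0) (erase B (C x) ω.j1)).toSign := by
      intro x
      have hx := hdec x (erase B (C x)) (by
        refine le_trans ?_ hcard
        refine Nat.cast_le.2 (Finset.card_le_card fun j hj => ?_)
        by_contra hjB
        exact (Finset.mem_filter.1 hj).2 (if_neg hjB))
      rw [Finset.sum_filter] at hx
      have e : (x i).toSign *
          ∑ ω, D ω * (ω.f (erase B (C x) ω.j0) (erase B (C x) ω.j1)).toSign =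
          2 * (∑ ω, if ω.f (erase B (C x) ω.j0) (erase B (C x) ω.j1) = x i then D ω else 0) -
            ∑ ω, D ω := by
        rw [Finset.mul_sum, Finset.mul_sum, ← Finset.sum_sub_distrib]
        refine Finset.sum_congr rfl fun ω _ => ?_
        cases x i <;> cases ω.f (erase B (C x) ω.j0) (erase B (C x) ω.j1) <;>
          simp [Bool.toSign] <;> ring
      rw [e, hD1]
      linarith
    have hsign : ∑ x : Fin n → Bool, (x i).toSign = 0 := by
      have := sum_cubeChar_mul_cubeChar {i} (∅ : Finset (Fin n))
      simpa [cubeChar] using this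
    have e : ∀ x, (x i).toSign * (parityVec (C x) ⬝ᵥ
        (∑ ω, (D ω * (m * δ / 2)) • O ω) *ᵥ parityVec (C x)) =
        (m * δ) * ((x i).toSign *
          ∑ ω, D ω * (ω.f (erase B (C x) ω.j0) (erase B (C x) ω.j1)).toSign) -
        (x i).toSign * (m * δ / 2 * ∑ ω, D ω * α ω) := by
      intro x
      rw [hform]
      have : ∀ ω, D ω * (m * δ / 2) * (parityVec (C x) ⬝ᵥ O ω *ᵥ parityVec (C x)) =
          m * δ * (D ω * (ω.f (erase B (C x) ω.j0) (erase B (C x) ω.j1)).toSign) -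
            m * δ / 2 * (D ω * α ω) := by
        intro ω
        rw [mul_right_comm, hobs ω]
        ring
      rw [Finset.sum_congr rfl fun ω _ => this ω, Finset.sum_sub_distrib, ← Finset.mul_sum,
        ← Finset.mul_sum]
      ring
    rw [Finset.sum_congr rfl fun x _ => e x, Finset.sum_sub_distrib, ← Finset.sum_mul, hsign,
      zero_mul, sub_zero, ← Finset.mul_sum]
    have := Finset.sum_le_sum fun x (_ : x ∈ Finset.univ) => hadv x
    simp only [Finset.sum_const, Finset.card_univ, Fintype.card_fun, Fintype.card_bool,
      Fintype.card_fin, nsmul_eq_mul, Nat.cast_pow, Nat.cast_ofNat] at this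
    calc (2 : ℝ) ^ n * (2 * ε * (m * δ)) = m * δ * (2 ^ n * (2 * ε)) := by ring
      _ ≤ _ := mul_le_mul_of_nonneg_left this (by positivity)
  · intro x
    rw [hKform, ← hswap]
    calc _ ≤ ∑ ω, D ω * (m * δ / 2) * (2 * 2 ^ b) := by
          refine Finset.sum_le_sum fun ω _ => mul_le_mul_of_nonneg_left ?_ (hq ω)
          rw [Finset.sum_congr rfl (g := fun _ => (1 : ℝ)) fun s _ => by
            rw [sq, parityVec, cubeChar_mul_self]]
          rw [Finset.sum_const, nsmul_eq_mul, mul_one]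
          exact_mod_cast hRcard ω
      _ = m * δ * 2 ^ b := by
          rw [← Finset.sum_mul, ← Finset.sum_mul, hD1]
          ring

end IsLDCDecoder

open Matrix

/-- main LDC lower bound: if `C : {0,1}^n → ({0,1}^ℓ)^m` is a
`(2, δ, ε)`-locally decodable code using `b` bits, then `m ≥ 2^{d·n - log₂ u}` with
`u = Σ_{i=0}^{b} binom(ℓ,i)` and `d = (1 - H(1/2 + ε/2^{b+1})) · δ · 2^b / u`. -/
theorem stmt12 (n m ℓ b : ℕ) (δ ε : ℝ) (hn : 1 ≤ n) (hδ : 0 < δ) (hε : 0 < ε)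
    (C : (Fin n → Bool) → Fin m → Fin ℓ → Bool)
    (h : IsLDC n m ℓ b δ ε C)
    (u : ℕ) (hu : u = ∑ i ∈ Finset.range (b + 1), ℓ.choose i)
    (d : ℝ) (hd : d = (1 - binEnt (1 / 2 + ε / 2 ^ (b + 1))) * δ * 2 ^ b / u) :
    (2 : ℝ) ^ (d * n - Real.logb 2 u) ≤ m := by
  have hε2 : ∀ i : Fin n, 1 ≤ b ∧ 1 / 2 + ε ≤ 1 ∧ 0 < m := by
    intro i
    obtain ⟨D, hD⟩ := h i
    refine ⟨hD.one_le_bits hδ.le hε, hD.half_add_le_one hδ.le, ?_⟩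
    by_contra hm
    obtain rfl : m = 0 := by omega
    have : IsEmpty (DecTuple 0 ℓ) := ⟨fun ω => ω.j0.elim0⟩
    simpa using hD.2.1
  obtain ⟨hb, hε1, hm⟩ := hε2 ⟨0, hn⟩
  have hm' : (0 : ℝ) < m := by exact_mod_cast hm
  have hu1 : 0 < u := by
    rw [hu]
    exact Finset.sum_pos' (fun _ _ => Nat.zero_le _) ⟨0, by simp, by simp⟩
  have hu' : (0 : ℝ) < u := by exact_mod_cast hu1
  have hN : (Fintype.card (ParityIndex m ℓ b) : ℝ) = m * u := by
    rw [ParityIndex.card_eq, ← hu, Nat.cast_mul]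
  have : Nonempty (ParityIndex m ℓ b) := ⟨(⟨0, hm⟩, ⟨∅, by simp⟩)⟩
  choose D hD using h
  choose M K hM hK hMK hcor hKle using fun i => (hD i).exists_matrices hδ hb hm
  set t : ℝ := ε / 2 ^ b with ht
  have hmain := Matrix.sum_le_log_card n (fun i => t • M i) (fun i => t ^ 2 • K i)
    (fun i => (hM i).real_smul _) (fun i => (hK i).real_smul _)
    (fun i v => by
      have := mul_le_mul_of_nonneg_left (hMK i v) (sq_nonneg t)
      simpa [Matrix.smul_mulVec, sq, mul_assoc] using this)
    (fun x => ParityIndex.parityVec (C x)) (fun x => ParityIndex.parityVec_dotProduct_self (C x))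
  have hlow : (2 : ℝ) ^ n * (n * (t * (2 * ε * (m * δ)) - t ^ 2 * (m * δ * 2 ^ b))) ≤
      2 ^ n * (m * u) * Real.log (m * u) := by
    rw [← hN]
    refine le_trans ?_ hmain
    rw [Finset.sum_comm]
    have hi : ∀ i : Fin n, (2 : ℝ) ^ n * (t * (2 * ε * (m * δ)) - t ^ 2 * (m * δ * 2 ^ b)) ≤
        ∑ x, ((x i).toSign * (ParityIndex.parityVec (C x) ⬝ᵥ
            (t • M i) *ᵥ ParityIndex.parityVec (C x)) -
          ParityIndex.parityVec (C x) ⬝ᵥ (t ^ 2 • K i) *ᵥ ParityIndex.parityVec (C x)) := by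
      intro i
      have h1 := mul_le_mul_of_nonneg_left (hcor i) (show 0 ≤ t by positivity)
      have h2 := Finset.sum_le_sum fun x (_ : x ∈ Finset.univ) =>
        mul_le_mul_of_nonneg_left (hKle i x) (sq_nonneg t)
      simp only [Finset.sum_const, Finset.card_univ, Fintype.card_fun, Fintype.card_bool,
        Fintype.card_fin, nsmul_eq_mul, Nat.cast_pow, Nat.cast_ofNat] at h2
      rw [Finset.mul_sum] at h1
      simp only [Matrix.smul_mulVec, dotProduct_smul, smul_eq_mul, Finset.sum_sub_distrib,
        mul_left_comm _ t]
      linarith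
    have := Finset.sum_le_sum fun i (_ : i ∈ Finset.univ) => hi i
    rw [Finset.sum_const, Finset.card_univ, Fintype.card_fin, nsmul_eq_mul] at this
    linarith
  have hlog : n * (ε ^ 2 * δ / (2 ^ b * u)) ≤ Real.log (m * u) := by
    rw [mul_assoc ((2 : ℝ) ^ n) (m * u)] at hlow
    replace hlow := le_of_mul_le_mul_left hlow (by positivity)
    have e : n * (t * (2 * ε * (m * δ)) - t ^ 2 * (m * δ * 2 ^ b)) =
        m * u * (n * (ε ^ 2 * δ / (2 ^ b * u))) := by
      rw [ht]; field_simp; ring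
    rw [e] at hlow
    exact le_of_mul_le_mul_left hlow (by positivity)
  have hη := one_sub_binEnt_mul_log_two_le (η := ε / 2 ^ (b + 1)) (by positivity) (by
    rw [div_lt_iff₀ (by positivity)]
    have : (1 : ℝ) ≤ 2 ^ b := one_le_pow₀ (by norm_num)
    have : (2 : ℝ) ≤ 2 ^ b := by
      calc (2 : ℝ) = 2 ^ 1 := (pow_one _).symm
        _ ≤ 2 ^ b := pow_le_pow_right₀ (by norm_num) hb
    rw [pow_succ]
    linarith)
  have hl2 : 0 < Real.log 2 := Real.log_pos (by norm_num)
  have hdn : d * n ≤ Real.logb 2 (m * u) := by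
    rw [Real.logb, le_div_iff₀ hl2]
    refine le_trans ?_ hlog
    calc d * n * Real.log 2 = ((1 - binEnt (1 / 2 + ε / 2 ^ (b + 1))) * Real.log 2) *
          (δ * 2 ^ b / u * n) := by rw [hd]; ring
      _ ≤ (4 * (ε / 2 ^ (b + 1)) ^ 2) * (δ * 2 ^ b / u * n) :=
          mul_le_mul_of_nonneg_right hη (by positivity)
      _ = n * (ε ^ 2 * δ / (2 ^ b * u)) := by
          rw [pow_succ]; field_simp; ring
  rw [← Real.le_logb_iff_rpow_le (by norm_num) hm']
  rw [Real.logb_mul hm'.ne' hu'.ne'] at hdn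
  linarith
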